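/- Let Φ be an m×N complex matrix with δ_{3s}(Φ) ≤ δ_{4s}(Φ) ≤ 0.1. Let x ∈ ℂ^N be s-sparse, let e ∈ ℂ^m, and let u = Φx + e. Let a ∈ ℂ^N be an s-sparse approximation, and let T be a set of at most 3s indices containing supp(a). Run three steps of Richardson's iteration z^{ℓ+1} = Φ_T*u − (Φ_T*Φ_T − I)z^ℓ initialized with z^0 = a (restricted to T), and define b ∈ ℂ^N by b|_T = z^3 and b|_{T^c} = 0. Then ‖x − b‖₂ ≤ 1.112·‖x|_{T^c}‖₂ + 0.0022·‖x − a‖₂ + 1.062·‖e‖₂. -/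

import Mathlib

open Matrix
open scoped BigOperators Classical

/-- The Euclidean (ℓ₂) norm of a finitely indexed complex vector. -/
noncomputable def l2 {ι : Type*} [Fintype ι] (x : ι → ℂ) : ℝ :=
  Real.sqrt (∑ i, ‖x i‖ ^ 2)

/-- The ℓ₁ norm of a finitely indexed complex vector. -/
noncomputable def l1 {ι : Type*} [Fintype ι] (x : ι → ℂ) : ℝ := ∑ i, ‖x i‖

/-- The ℓ∞ (supremum) norm of a finitely indexed complex vector. -/
noncomputable def linf {ι : Type*} [Fintype ι] (x : ι → ℂ) : ℝ := ⨆ i, ‖x i‖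

/-- The support of a vector, as a finite set of coordinates. -/
noncomputable def suppF {N : ℕ} (x : Fin N → ℂ) : Finset (Fin N) :=
  Finset.univ.filter fun i => x i ≠ 0

/-- A vector is `s`-sparse when it has at most `s` nonzero entries. -/
def Sparse {N : ℕ} (s : ℕ) (x : Fin N → ℂ) : Prop := (suppF x).card ≤ s

/-- Restriction of a vector to a set `T` of coordinates: equal to `x` on `T`, zero off `T`. -/
noncomputable def restrictTo {N : ℕ} (x : Fin N → ℂ) (T : Finset (Fin N)) : Fin N → ℂ :=
  fun i => if i ∈ T then x i else 0

/-- `y` is a best `s`-sparse approximation of `x`: it agrees with `x` on a set of `s`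
coordinates of largest magnitude and vanishes elsewhere. -/
def IsSparseApprox {N : ℕ} (s : ℕ) (x y : Fin N → ℂ) : Prop :=
  ∃ T : Finset (Fin N), T.card = min s N ∧ y = restrictTo x T ∧
    ∀ i ∈ T, ∀ j ∉ T, ‖x j‖ ≤ ‖x i‖

/-- The `r`-th restricted isometry constant of `Φ`: the least `δ ≥ 0` such that
`(1-δ)‖x‖² ≤ ‖Φx‖² ≤ (1+δ)‖x‖²` for all `r`-sparse `x`. -/
noncomputable def RIC {m N : ℕ} (Φ : Matrix (Fin m) (Fin N) ℂ) (r : ℕ) : ℝ :=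
  sInf {δ : ℝ | 0 ≤ δ ∧ ∀ x : Fin N → ℂ, Sparse r x →
    (1 - δ) * l2 x ^ 2 ≤ l2 (Φ.mulVec x) ^ 2 ∧ l2 (Φ.mulVec x) ^ 2 ≤ (1 + δ) * l2 x ^ 2}

/-- The column submatrix of `Φ` with columns indexed by the finite set `T`. -/
noncomputable def colSub {m N : ℕ} (Φ : Matrix (Fin m) (Fin N) ℂ) (T : Finset (Fin N)) :
    Matrix (Fin m) {i // i ∈ T} ℂ :=
  Matrix.of fun r c => Φ r c.1

/-- The least-squares estimate `Φ_T† u = (Φ_T* Φ_T)⁻¹ Φ_T* u`, viewed as a vector in `ℂ^N`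
supported on `T`. -/
noncomputable def pinvApply {m N : ℕ} (Φ : Matrix (Fin m) (Fin N) ℂ) (T : Finset (Fin N))
    (u : Fin m → ℂ) : Fin N → ℂ :=
  fun j =>
    if h : j ∈ T then (((colSub Φ T)ᴴ * colSub Φ T)⁻¹ * (colSub Φ T)ᴴ).mulVec u ⟨j, h⟩
    else 0

/-- One iteration of CoSaMP with samples `u` and sparsity level `s`, mapping the current
approximation `a` to the next approximation `a'`. -/
def CoSaMPStep {m N : ℕ} (Φ : Matrix (Fin m) (Fin N) ℂ) (u : Fin m → ℂ) (s : ℕ)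
    (a a' : Fin N → ℂ) : Prop :=
  ∃ y2s : Fin N → ℂ,
    IsSparseApprox (2 * s) (Φᴴ.mulVec (u - Φ.mulVec a)) y2s ∧
    IsSparseApprox s (pinvApply Φ (suppF y2s ∪ suppF a) u) a'

/-- `a` is a sequence of approximations produced by CoSaMP: `a 0 = 0` and each successive
approximation arises from one CoSaMP iteration. -/
def CoSaMPSeq {m N : ℕ} (Φ : Matrix (Fin m) (Fin N) ℂ) (u : Fin m → ℂ) (s : ℕ)
    (a : ℕ → Fin N → ℂ) : Prop :=
  a 0 = 0 ∧ ∀ k, CoSaMPStep Φ u s (a k) (a (k + 1))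

/-- The spectral norm (ℓ₂ → ℓ₂ operator norm) of a matrix. -/
noncomputable def specNorm {a b : Type*} [Fintype a] [Fintype b] (M : Matrix a b ℂ) : ℝ :=
  sSup ((fun x => l2 (M.mulVec x)) '' {x | l2 x ≤ 1})

section Polarization

variable {E G : Type*} [NormedAddCommGroup E] [InnerProductSpace ℂ E]
  [NormedAddCommGroup G] [InnerProductSpace ℂ G]

/-- An approximate isometry on a subspace approximately preserves real inner products there. -/
theorem re_inner_map_sub_le_of_approx_isometry (L : E →ₗ[ℂ] G) (S : Submodule ℂ E) {δ : ℝ}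
    (h : ∀ v ∈ S, |‖L v‖ ^ 2 - ‖v‖ ^ 2| ≤ δ * ‖v‖ ^ 2) {u v : E} (hu : u ∈ S) (hv : v ∈ S) :
    (inner ℂ (L u) (L v)).re - (inner ℂ u v).re ≤ δ * (‖u‖ * ‖v‖) := by
  have key : ∀ p ∈ S, ∀ q ∈ S,
      2 * ((inner ℂ (L p) (L q)).re - (inner ℂ p q).re) ≤ δ * (‖p‖ ^ 2 + ‖q‖ ^ 2) := by
    intro p hp q hq
    have h₁ := (abs_le.1 (h _ (S.add_mem hp hq))).2
    have h₂ := (abs_le.1 (h _ (S.sub_mem hp hq))).1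
    rw [map_add] at h₁
    rw [map_sub] at h₂
    have e₁ := norm_add_sq (𝕜 := ℂ) p q
    have e₂ := norm_sub_sq (𝕜 := ℂ) p q
    have e₃ := norm_add_sq (𝕜 := ℂ) (L p) (L q)
    have e₄ := norm_sub_sq (𝕜 := ℂ) (L p) (L q)
    simp only [RCLike.re_to_complex] at e₁ e₂ e₃ e₄
    rw [e₁, e₃] at h₁
    rw [e₂, e₄] at h₂
    linarith
  rcases eq_or_ne u 0 with rfl | hu0
  · simp
  rcases eq_or_ne v 0 with rfl | hv0
  · simp
  have hun := norm_pos_iff.2 hu0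
  have hvn := norm_pos_iff.2 hv0
  have hk := key ((‖v‖ : ℂ) • u) (S.smul_mem _ hu) ((‖u‖ : ℂ) • v) (S.smul_mem _ hv)
  simp only [map_smul, inner_smul_left, inner_smul_right, norm_smul, Complex.conj_ofReal,
    Complex.re_ofReal_mul, Complex.norm_real, norm_norm] at hk
  refine le_of_mul_le_mul_left ?_ (mul_pos hun hvn)
  linarith

end Polarization

section Richardson

variable {F G : Type*} [NormedAddCommGroup F] [InnerProductSpace ℂ F] [FiniteDimensional ℂ F]
  [NormedAddCommGroup G] [InnerProductSpace ℂ G] [FiniteDimensional ℂ G]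

theorem norm_adjoint_map_sub_le_of_approx_isometry (L : F →ₗ[ℂ] G) {δ : ℝ}
    (h : ∀ v, |‖L v‖ ^ 2 - ‖v‖ ^ 2| ≤ δ * ‖v‖ ^ 2) (v : F) :
    ‖LinearMap.adjoint L (L v) - v‖ ≤ δ * ‖v‖ := by
  rcases eq_or_ne (LinearMap.adjoint L (L v) - v) 0 with h0 | h0
  · rcases eq_or_ne v 0 with rfl | hv
    · simp
    have hv' := norm_pos_iff.2 hv
    have hδ : 0 ≤ δ := nonneg_of_mul_nonneg_left ((abs_nonneg _).trans (h v)) (by positivity)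
    rw [h0, norm_zero]
    positivity
  set q := LinearMap.adjoint L (L v) - v with hq
  have hp := re_inner_map_sub_le_of_approx_isometry L ⊤ (fun v _ => h v)
    (Submodule.mem_top : q ∈ ⊤) (Submodule.mem_top : v ∈ ⊤)
  have hs : (inner ℂ (L q) (L v)).re - (inner ℂ q v).re = ‖q‖ ^ 2 := by
    rw [← LinearMap.adjoint_inner_right, ← Complex.sub_re, ← inner_sub_right, ← hq,
      inner_self_eq_norm_sq_to_K]
    norm_cast
  refine le_of_mul_le_mul_left ?_ (norm_pos_iff.2 h0)
  nlinarith

/-- A least-squares solution operator: the normal equations of an injective map are solvable, and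
the solution has image no longer than the data. -/
theorem exists_normal_equation_solution (L : F →ₗ[ℂ] G) (hL : Function.Injective L) (e : G) :
    ∃ h : F, LinearMap.adjoint L (L h) = LinearMap.adjoint L e ∧ ‖L h‖ ≤ ‖e‖ := by
  have hinj : Function.Injective (LinearMap.adjoint L ∘ₗ L) := by
    rw [injective_iff_map_eq_zero]
    intro v hv
    apply hL
    rw [map_zero, ← inner_self_eq_zero (𝕜 := ℂ), ← LinearMap.adjoint_inner_right]
    rw [LinearMap.comp_apply] at hv
    rw [hv, inner_zero_right]
  obtain ⟨h, hh⟩ := LinearMap.injective_iff_surjective.1 hinj (LinearMap.adjoint L e)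
  rw [LinearMap.comp_apply] at hh
  refine ⟨h, hh, ?_⟩
  have h₁ : ‖L h‖ ^ 2 = (inner ℂ (L h) e).re := by
    rw [← LinearMap.adjoint_inner_right, ← hh, LinearMap.adjoint_inner_right,
      inner_self_eq_norm_sq_to_K]
    norm_cast
  have h₂ : (inner ℂ (L h) e).re ≤ ‖L h‖ * ‖e‖ := re_inner_le_norm (𝕜 := ℂ) (L h) e
  nlinarith [norm_nonneg (L h), norm_nonneg e]

/-- Three Richardson steps for the normal equations of a near isometry `L`, with data
`L w + c + e`. -/
theorem richardson_three_steps (L : F →ₗ[ℂ] G)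
    (h : ∀ v, |‖L v‖ ^ 2 - ‖v‖ ^ 2| ≤ 0.1 * ‖v‖ ^ 2) (w : F) (c e : G) {r : ℝ}
    (hc : ‖LinearMap.adjoint L c‖ ≤ 0.1 * r) (z : ℕ → F)
    (hz : ∀ n, z (n + 1) =
      LinearMap.adjoint L (L w + c + e) - (LinearMap.adjoint L (L (z n)) - z n)) :
    ‖w - z 3‖ ≤ 0.111 * r + 0.001 * ‖w - z 0‖ + 1.062 * ‖e‖ := by
  have hinj : Function.Injective L := by
    rw [injective_iff_map_eq_zero]
    intro v hv
    have h₁ := (abs_le.1 (h v)).1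
    rw [hv, norm_zero] at h₁
    exact norm_eq_zero.1 (by nlinarith [norm_nonneg v])
  obtain ⟨k, hk, hke⟩ := exists_normal_equation_solution L hinj e
  have hkn : ‖k‖ ≤ 1.06 * ‖e‖ := by
    have h₁ := (abs_le.1 (h k)).1
    refine abs_le_of_sq_le_sq' ?_ (by positivity) |>.2
    nlinarith [norm_nonneg (L k), norm_nonneg e]
  have step : ∀ n, ‖w + k - z (n + 1)‖ ≤ 0.1 * ‖w + k - z n‖ + 0.1 * r := by
    intro n
    have : w + k - z (n + 1) =
        -((LinearMap.adjoint L (L (w + k - z n)) - (w + k - z n)) + LinearMap.adjoint L c) := by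
      rw [hz]
      simp only [map_add, map_sub, hk]
      abel
    rw [this, norm_neg]
    exact (norm_add_le _ _).trans
      (add_le_add (norm_adjoint_map_sub_le_of_approx_isometry L h _) hc)
  have h₀ : ‖w + k - z 0‖ ≤ ‖w - z 0‖ + ‖k‖ := by
    rw [add_sub_right_comm]
    exact norm_add_le _ _
  have h₃ : ‖w - z 3‖ ≤ ‖w + k - z 3‖ + ‖k‖ := by
    have : w - z 3 = w + k - z 3 - k := by abel
    rw [this]
    exact norm_sub_le _ _
  have s₀ := step 0
  have s₁ := step 1
  have s₂ := step 2
  norm_num only [zero_add] at s₀ s₁ s₂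
  linarith [norm_nonneg e]

end Richardson

theorem l2_eq_norm_toLp {ι : Type*} [Fintype ι] (x : ι → ℂ) : l2 x = ‖WithLp.toLp 2 x‖ := by
  rw [EuclideanSpace.norm_eq, l2]

theorem l2_mulVec_le {m N : ℕ} (Φ : Matrix (Fin m) (Fin N) ℂ) :
    ∃ C : ℝ, ∀ x, l2 (Φ.mulVec x) ≤ C * l2 x := by
  refine ⟨‖LinearMap.toContinuousLinearMap (Matrix.toEuclideanLin Φ)‖, fun x => ?_⟩
  rw [l2_eq_norm_toLp, l2_eq_norm_toLp]
  exact (LinearMap.toContinuousLinearMap (Matrix.toEuclideanLin Φ)).le_opNorm (WithLp.toLp 2 x)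

theorem abs_l2_mulVec_sq_sub_le_of_RIC_le {m N : ℕ} {Φ : Matrix (Fin m) (Fin N) ℂ} {r : ℕ} {δ : ℝ}
    (hδ : RIC Φ r ≤ δ) {x : Fin N → ℂ} (hx : Sparse r x) :
    |l2 (Φ.mulVec x) ^ 2 - l2 x ^ 2| ≤ δ * l2 x ^ 2 := by
  set A := {δ : ℝ | 0 ≤ δ ∧ ∀ x : Fin N → ℂ, Sparse r x →
    (1 - δ) * l2 x ^ 2 ≤ l2 (Φ.mulVec x) ^ 2 ∧ l2 (Φ.mulVec x) ^ 2 ≤ (1 + δ) * l2 x ^ 2} with hA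
  have hne : A.Nonempty := by
    obtain ⟨C, hC⟩ := l2_mulVec_le Φ
    refine ⟨1 + C ^ 2, by positivity, fun y _ => ⟨?_, ?_⟩⟩
    · nlinarith [sq_nonneg (l2 (Φ.mulVec y)), sq_nonneg (C * l2 y)]
    · have h₀ : 0 ≤ l2 (Φ.mulVec y) := Real.sqrt_nonneg _
      have := pow_le_pow_left₀ h₀ (hC y) 2
      nlinarith [sq_nonneg (l2 y)]
  refine le_of_forall_pos_le_add fun ε hε => ?_
  have hη : 0 < ε / (l2 x ^ 2 + 1) := by positivity
  obtain ⟨d, hd, hlt⟩ := exists_lt_of_csInf_lt hne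
    (lt_of_le_of_lt hδ (lt_add_of_pos_right δ hη))
  obtain ⟨h₁, h₂⟩ := hd.2 x hx
  have h₃ : ε / (l2 x ^ 2 + 1) * l2 x ^ 2 ≤ ε := by
    rw [div_mul_eq_mul_div, div_le_iff₀ (by positivity)]
    nlinarith
  have h₄ := mul_le_mul_of_nonneg_right hlt.le (sq_nonneg (l2 x))
  rw [abs_le]
  constructor <;> linarith

/-- Vectors of a Euclidean space that vanish off `T`. -/
def supportedOn {N : ℕ} (T : Finset (Fin N)) : Submodule ℂ (EuclideanSpace ℂ (Fin N)) where
  carrier := {v | ∀ i ∉ T, v i = 0}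
  add_mem' hu hv i hi := by simp [hu i hi, hv i hi]
  zero_mem' := by simp
  smul_mem' c v hv i hi := by simp [hv i hi]

theorem sparse_of_mem_supportedOn {N r : ℕ} {T : Finset (Fin N)} (hT : T.card ≤ r)
    {v : EuclideanSpace ℂ (Fin N)} (hv : v ∈ supportedOn T) : Sparse r (WithLp.ofLp v) := by
  refine (Finset.card_le_card fun i hi => ?_).trans hT
  by_contra h
  exact (Finset.mem_filter.1 hi).2 (hv i h)

/-- Extension by zero of a vector indexed by `T`. -/
noncomputable def extendZero {N : ℕ} (T : Finset (Fin N)) (v : {i // i ∈ T} → ℂ) : Fin N → ℂ :=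
  fun j => if h : j ∈ T then v ⟨j, h⟩ else 0

theorem sum_dite_mem {N : ℕ} {M : Type*} [AddCommMonoid M] (T : Finset (Fin N))
    (f : {i // i ∈ T} → M) : ∑ j, (if h : j ∈ T then f ⟨j, h⟩ else 0) = ∑ i, f i := by
  have h₁ : ∑ j, (if h : j ∈ T then f ⟨j, h⟩ else 0) =
      ∑ j ∈ T, (if h : j ∈ T then f ⟨j, h⟩ else 0) :=
    (Finset.sum_subset (Finset.subset_univ T) fun j _ hj => by simp [hj]).symm
  rw [h₁, ← Finset.sum_coe_sort]
  exact Finset.sum_congr rfl fun i _ => by simp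

theorem l2_extendZero {N : ℕ} (T : Finset (Fin N)) (v : {i // i ∈ T} → ℂ) :
    l2 (extendZero T v) = l2 v := by
  rw [l2, l2, ← sum_dite_mem T]
  congr 1
  refine Finset.sum_congr rfl fun j _ => ?_
  by_cases h : j ∈ T <;> simp [extendZero, h]

theorem mulVec_extendZero {m N : ℕ} (Φ : Matrix (Fin m) (Fin N) ℂ) (T : Finset (Fin N))
    (v : {i // i ∈ T} → ℂ) : Φ.mulVec (extendZero T v) = (colSub Φ T).mulVec v := by
  ext i
  rw [Matrix.mulVec, Matrix.mulVec, dotProduct, dotProduct, ← sum_dite_mem T]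
  refine Finset.sum_congr rfl fun j _ => ?_
  by_cases h : j ∈ T <;> simp [extendZero, colSub, h]

theorem extendZero_mem_supportedOn {N : ℕ} (T : Finset (Fin N)) (v : {i // i ∈ T} → ℂ) :
    WithLp.toLp 2 (extendZero T v) ∈ supportedOn T := fun i hi => by simp [extendZero, hi]

theorem l2_restrict_le {N : ℕ} (T : Finset (Fin N)) (x : Fin N → ℂ) :
    l2 (fun i : {i // i ∈ T} => x i) ≤ l2 x := by
  rw [← l2_extendZero]
  refine Real.sqrt_le_sqrt (Finset.sum_le_sum fun j _ => ?_)
  by_cases h : j ∈ T <;> simp [extendZero, h]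

theorem extendZero_restrict_add_restrictTo_compl {N : ℕ} (T : Finset (Fin N)) (x : Fin N → ℂ) :
    extendZero T (fun i => x i) + restrictTo x Tᶜ = x := by
  ext j
  by_cases h : j ∈ T <;> simp [extendZero, restrictTo, h]

/-- Columns in `T` are nearly orthogonal to the image of a vector supported off `T`. -/
theorem norm_adjoint_colSub_le {m N r : ℕ} {Φ : Matrix (Fin m) (Fin N) ℂ} {δ : ℝ}
    (hδ : RIC Φ r ≤ δ) (hδ₀ : 0 ≤ δ) {T : Finset (Fin N)} {y : Fin N → ℂ}
    (hy : ∀ i ∈ T, y i = 0) (hcard : (T ∪ suppF y).card ≤ r) :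
    ‖LinearMap.adjoint (Matrix.toEuclideanLin (colSub Φ T)) (WithLp.toLp 2 (Φ.mulVec y))‖ ≤
      δ * l2 y := by
  set g := LinearMap.adjoint (Matrix.toEuclideanLin (colSub Φ T)) (WithLp.toLp 2 (Φ.mulVec y))
    with hg
  rcases eq_or_ne g 0 with h0 | h0
  · rw [h0, norm_zero]
    exact mul_nonneg hδ₀ (Real.sqrt_nonneg _)
  set G : EuclideanSpace ℂ (Fin N) := WithLp.toLp 2 (extendZero T (WithLp.ofLp g)) with hG
  set Y : EuclideanSpace ℂ (Fin N) := WithLp.toLp 2 y with hY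
  have hGm : G ∈ supportedOn (T ∪ suppF y) := fun i hi =>
    extendZero_mem_supportedOn T _ i fun h => hi (Finset.mem_union_left _ h)
  have hYm : Y ∈ supportedOn (T ∪ suppF y) := fun i hi => by
    by_contra h
    exact hi (Finset.mem_union_right _ (Finset.mem_filter.2 ⟨Finset.mem_univ _, h⟩))
  have hp := re_inner_map_sub_le_of_approx_isometry (Matrix.toEuclideanLin Φ)
    (supportedOn (T ∪ suppF y)) (δ := δ) (fun v hv => by
      have := abs_l2_mulVec_sq_sub_le_of_RIC_le hδ (sparse_of_mem_supportedOn hcard hv)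
      rwa [l2_eq_norm_toLp, l2_eq_norm_toLp] at this) hGm hYm
  have hGn : ‖G‖ = ‖g‖ := by
    rw [hG, ← l2_eq_norm_toLp, l2_extendZero, l2_eq_norm_toLp]
  have horth : inner ℂ G Y = 0 := by
    rw [PiLp.inner_apply]
    refine Finset.sum_eq_zero fun i _ => ?_
    by_cases h : i ∈ T
    · simp [hY, hy i h]
    · simp [hG, extendZero, h]
  have himg : Matrix.toEuclideanLin Φ G = Matrix.toEuclideanLin (colSub Φ T) g :=
    congrArg (WithLp.toLp 2) (mulVec_extendZero Φ T _)
  have hin : (inner ℂ (Matrix.toEuclideanLin Φ G) (Matrix.toEuclideanLin Φ Y)).re = ‖g‖ ^ 2 := by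
    rw [himg, ← LinearMap.adjoint_inner_right]
    change (inner ℂ g g).re = _
    rw [inner_self_eq_norm_sq_to_K]
    norm_cast
  rw [hin, horth, hGn, Complex.zero_re, sub_zero] at hp
  rw [l2_eq_norm_toLp]
  refine le_of_mul_le_mul_left ?_ (norm_pos_iff.2 h0)
  nlinarith

/-- **Estimation by iterative least squares.**  Running three steps of Richardson's
iteration for the least-squares problem on `T`, initialized with the current `s`-sparse
approximation `a`, produces `b` with
`‖x − b‖₂ ≤ 1.112‖x|_{T^c}‖₂ + 0.0022‖x − a‖₂ + 1.062‖e‖₂`. -/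
theorem iterative_ls_estimate
    {m N : ℕ} (s : ℕ) (Φ : Matrix (Fin m) (Fin N) ℂ)
    (h34 : RIC Φ (3 * s) ≤ RIC Φ (4 * s)) (hΦ : RIC Φ (4 * s) ≤ 0.1)
    (x : Fin N → ℂ) (hx : Sparse s x) (e : Fin m → ℂ)
    (u : Fin m → ℂ) (hu : u = Φ.mulVec x + e)
    (a : Fin N → ℂ) (ha : Sparse s a)
    (T : Finset (Fin N)) (hT : T.card ≤ 3 * s) (haT : suppF a ⊆ T)
    (z : ℕ → {i // i ∈ T} → ℂ) (hz0 : z 0 = fun i => a i.1)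
    (hz : ∀ ℓ : ℕ, z (ℓ + 1) = (colSub Φ T)ᴴ.mulVec u -
      ((colSub Φ T)ᴴ * colSub Φ T - 1).mulVec (z ℓ))
    (b : Fin N → ℂ) (hb : b = fun j => if h : j ∈ T then z 3 ⟨j, h⟩ else 0) :
    l2 (x - b) ≤ 1.112 * l2 (restrictTo x Tᶜ) + 0.0022 * l2 (x - a) + 1.062 * l2 e := by
  set y := restrictTo x Tᶜ with hy
  set w : {i // i ∈ T} → ℂ := fun i => x i with hw
  have hsplit : extendZero T w + y = x := extendZero_restrict_add_restrictTo_compl T x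
  set L := Matrix.toEuclideanLin (colSub Φ T) with hL
  have hnear : ∀ v, |‖L v‖ ^ 2 - ‖v‖ ^ 2| ≤ 0.1 * ‖v‖ ^ 2 := by
    intro v
    have := abs_l2_mulVec_sq_sub_le_of_RIC_le hΦ
      (sparse_of_mem_supportedOn (hT.trans (Nat.mul_le_mul_right s (by norm_num)))
        (extendZero_mem_supportedOn T (WithLp.ofLp v)))
    rwa [l2_extendZero, mulVec_extendZero, l2_eq_norm_toLp, l2_eq_norm_toLp] at this
  have hyT : ∀ i ∈ T, y i = 0 := fun i hi => by simp [hy, restrictTo, hi]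
  have hyx : suppF y ⊆ suppF x := by
    intro i hi
    refine Finset.mem_filter.2 ⟨Finset.mem_univ _, fun h => (Finset.mem_filter.1 hi).2 ?_⟩
    simp [hy, restrictTo, h]
  have hcard : (T ∪ suppF y).card ≤ 4 * s := by
    have h₁ := Finset.card_union_le T (suppF y)
    have h₂ := Finset.card_le_card hyx
    have h₃ : (suppF x).card ≤ s := hx
    omega
  have hc := norm_adjoint_colSub_le hΦ (by norm_num) hyT hcard
  have hrec : ∀ n, WithLp.toLp 2 (z (n + 1)) =
      LinearMap.adjoint L (L (WithLp.toLp 2 w) + WithLp.toLp 2 (Φ.mulVec y) + WithLp.toLp 2 e) -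
        (LinearMap.adjoint L (L (WithLp.toLp 2 (z n))) - WithLp.toLp 2 (z n)) := by
    intro n
    have hu' : u = (colSub Φ T).mulVec w + Φ.mulVec y + e := by
      rw [hu, ← mulVec_extendZero, ← Matrix.mulVec_add, hsplit]
    rw [hz, hL, ← Matrix.toEuclideanLin_conjTranspose_eq_adjoint, hu', Matrix.sub_mulVec,
      Matrix.one_mulVec, ← Matrix.mulVec_mulVec]
    rfl
  have hmain := richardson_three_steps L hnear _ _ _ hc (fun n => WithLp.toLp 2 (z n)) hrec
  simp only [← WithLp.toLp_sub, ← l2_eq_norm_toLp] at hmain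
  have h₀ : l2 (w - z 0) ≤ l2 (x - a) := by
    rw [hz0]
    exact l2_restrict_le T (x - a)
  have hdiff : x - b = y + extendZero T (w - z 3) := by
    ext j
    by_cases h : j ∈ T <;> simp [hb, hy, hw, restrictTo, extendZero, h]
  have htri : l2 (x - b) ≤ l2 y + l2 (w - z 3) := by
    rw [hdiff, ← l2_extendZero T (w - z 3), l2_eq_norm_toLp, l2_eq_norm_toLp, l2_eq_norm_toLp,
      WithLp.toLp_add]
    exact norm_add_le _ _
  have hy₀ : 0 ≤ l2 y := Real.sqrt_nonneg _
  have hxa₀ : 0 ≤ l2 (x - a) := Real.sqrt_nonneg _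
  linarith
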